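/- For every integer g ≥ 2, every τ ∈ ℍ_{g−1} and every z ∈ ℂ^{g−1}: lim_{t→+∞} q_t^{−8}·(F_g(T_t) − 4·F_{g−1}(τ)) = 1920·(2^{g−1}·Σ_{ε,δ∈{0,1}^{g−1}} θ_{[ε,δ]}(τ)^{14}·θ_{[ε,δ]}(τ,z)² − (Σ_{ε,δ∈{0,1}^{g−1}} θ_{[ε,δ]}(τ)⁸)·(Σ_{ε,δ∈{0,1}^{g−1}} θ_{[ε,δ]}(τ)⁶·θ_{[ε,δ]}(τ,z)²)). -/

import Mathlib

open scoped BigOperators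

noncomputable section

/-- The Siegel upper half-space: symmetric complex matrices with positive
definite imaginary part (indexed by a finite type `ι`). -/
def Siegel (ι : Type) [Fintype ι] : Set (Matrix ι ι ℂ) :=
  {τ | τ.IsSymm ∧ ∀ v : ι → ℝ, v ≠ 0 → 0 < ∑ i, ∑ j, v i * (τ i j).im * v j}

/-- The theta function with characteristic `[ε, δ]`. -/
def theta {ι : Type} [Fintype ι] (ε δ : ι → ZMod 2) (τ : Matrix ι ι ℂ) (z : ι → ℂ) : ℂ :=
  ∑' n : ι → ℤ, Complex.exp ((Real.pi : ℂ) * Complex.I *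
    ((∑ i, ∑ j, ((n i : ℂ) + ((ε i).val : ℂ) / 2) * τ i j * ((n j : ℂ) + ((ε j).val : ℂ) / 2)) +
     2 * ∑ i, ((n i : ℂ) + ((ε i).val : ℂ) / 2) * (z i + ((δ i).val : ℂ) / 2)))

/-- A theta characteristic, an element of `𝔽₂^{2g}`. -/
abbrev Char2 (ι : Type) := (ι → ZMod 2) × (ι → ZMod 2)

/-- Theta function, with the characteristic as a pair. -/
def thetaChar {ι : Type} [Fintype ι] (m : Char2 ι) (τ : Matrix ι ι ℂ) (z : ι → ℂ) : ℂ :=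
  theta m.1 m.2 τ z

/-- Theta constant. -/
def thetaConst {ι : Type} [Fintype ι] (m : Char2 ι) (τ : Matrix ι ι ℂ) : ℂ :=
  thetaChar m τ 0

/-- The modular form `F_g(τ) = 2^g·Σ_m θ_m(τ)^{16} − (Σ_m θ_m(τ)^8)²`. -/
noncomputable def Fmod (ι : Type) [Fintype ι] [DecidableEq ι] (τ : Matrix ι ι ℂ) : ℂ :=
  2 ^ (Fintype.card ι) * ∑ m : Char2 ι, thetaConst m τ ^ 16 -
    (∑ m : Char2 ι, thetaConst m τ ^ 8) ^ 2

/-- The degenerating period matrix `T_t = [[it, zᵀ],[z, τ]]`. -/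
noncomputable def Tmat {n : ℕ} (t : ℝ) (z : Fin n → ℂ) (τ : Matrix (Fin n) (Fin n) ℂ) :
    Matrix (Fin 1 ⊕ Fin n) (Fin 1 ⊕ Fin n) ℂ :=
  Matrix.fromBlocks (Matrix.of fun _ _ => (t : ℂ) * Complex.I)
    (Matrix.of fun _ j => z j) (Matrix.of fun i _ => z i) τ

/-- The boundary parameter `q_t = e^{−πt/4}`. -/
noncomputable def qdeg (t : ℝ) : ℝ := Real.exp (-Real.pi * t / 4)

/-- The genus-`g` characteristic `[(ε₁,ε),(δ₁,δ)]`. -/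
def extChar {n : ℕ} (ε₁ δ₁ : ZMod 2) (ε δ : Fin n → ZMod 2) : Char2 (Fin 1 ⊕ Fin n) :=
  (Sum.elim (fun _ => ε₁) ε, Sum.elim (fun _ => δ₁) δ)

/-- The Siegel condition in quantitative form: the imaginary part of `τ`, as a quadratic form,
is bounded below by `c` times the sum of squares. -/
def ImCoercive {ι : Type} [Fintype ι] (τ : Matrix ι ι ℂ) (c : ℝ) : Prop :=
  ∀ v : ι → ℝ, c * ∑ i, v i ^ 2 ≤ ∑ i, ∑ j, v i * (τ i j).im * v j

/-- The general summand of the theta series. -/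
def thetaTerm {ι : Type} [Fintype ι] (ε δ : ι → ZMod 2) (τ : Matrix ι ι ℂ) (z : ι → ℂ)
    (n : ι → ℤ) : ℂ :=
  Complex.exp ((Real.pi : ℂ) * Complex.I *
    ((∑ i, ∑ j, ((n i : ℂ) + ((ε i).val : ℂ) / 2) * τ i j * ((n j : ℂ) + ((ε j).val : ℂ) / 2)) +
     2 * ∑ i, ((n i : ℂ) + ((ε i).val : ℂ) / 2) * (z i + ((δ i).val : ℂ) / 2)))

theorem theta_eq_tsum {ι : Type} [Fintype ι] (ε δ : ι → ZMod 2) (τ : Matrix ι ι ℂ) (z : ι → ℂ) :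
    theta ε δ τ z = ∑' n, thetaTerm ε δ τ z n := rfl

/-- A finite product of absolutely convergent series, as a series over tuples. -/
theorem summable_norm_and_tsum_prod_fin {α : Type*} :
    ∀ (k : ℕ) (f : Fin k → α → ℂ), (∀ j, Summable fun a => ‖f j a‖) →
      (Summable fun N : Fin k → α => ‖∏ j, f j (N j)‖) ∧
        ∏ j, ∑' a, f j a = ∑' N : Fin k → α, ∏ j, f j (N j)
  | 0, f, _ => by
    refine ⟨(hasSum_fintype _).summable, ?_⟩
    rw [tsum_fintype]
    simp
  | k + 1, f, hf => by
    obtain ⟨hs, ht⟩ := summable_norm_and_tsum_prod_fin k (fun j => f j.succ) fun j => hf j.succ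
    let e : α × (Fin k → α) ≃ (Fin (k + 1) → α) := Fin.consEquiv fun _ => α
    have he : ∀ p : α × (Fin k → α),
        ∏ j, f j (e p j) = f 0 p.1 * ∏ j : Fin k, f j.succ (p.2 j) := fun p => by
      rw [Fin.prod_univ_succ]
      rfl
    constructor
    · rw [← e.summable_iff]
      refine ((hf 0).mul_norm hs).congr fun p => ?_
      simp only [Function.comp, he]
    · rw [Fin.prod_univ_succ, ht, tsum_mul_tsum_of_summable_norm (hf 0) hs, ← e.tsum_eq]
      exact tsum_congr fun p => (he p).symm

theorem summable_norm_prod {ι α : Type*} [Fintype ι] (f : ι → α → ℂ)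
    (hf : ∀ i, Summable fun a => ‖f i a‖) :
    Summable fun N : ι → α => ‖∏ i, f i (N i)‖ := by
  let e := Fintype.equivFin ι
  rw [← (e.arrowCongr (Equiv.refl α)).symm.summable_iff]
  refine (summable_norm_and_tsum_prod_fin _ (fun j => f (e.symm j))
    fun j => hf _).1.congr fun N => ?_
  congr 1
  refine Fintype.prod_equiv e.symm _ _ fun j => ?_
  simp [Equiv.arrowCongr]

theorem norm_thetaTerm {ι : Type} [Fintype ι] (ε δ : ι → ZMod 2) (τ : Matrix ι ι ℂ) (z : ι → ℂ)
    (n : ι → ℤ) :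
    ‖thetaTerm ε δ τ z n‖ = Real.exp (-Real.pi *
      ((∑ i, ∑ j, ((n i : ℝ) + ((ε i).val : ℝ) / 2) * (τ i j).im *
          ((n j : ℝ) + ((ε j).val : ℝ) / 2)) +
        2 * ∑ i, ((n i : ℝ) + ((ε i).val : ℝ) / 2) * (z i).im)) := by
  have hx : ∀ i, ((n i : ℂ) + ((ε i).val : ℂ) / 2) =
      (((n i : ℝ) + ((ε i).val : ℝ) / 2 : ℝ) : ℂ) := fun i => by push_cast; rfl
  have hd : ∀ i, (((δ i).val : ℂ) / 2) = ((((δ i).val : ℝ) / 2 : ℝ) : ℂ) := fun i => by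
    push_cast; rfl
  rw [thetaTerm, Complex.norm_exp]
  congr 1
  have h1 : ∀ w : ℂ, ((Real.pi : ℂ) * Complex.I * w).re = -Real.pi * w.im := fun w => by simp
  rw [h1]
  congr 1
  simp only [hx, hd, Complex.add_im, Complex.im_sum, Complex.im_mul_ofReal, Complex.im_ofReal_mul]
  rw [show (2 : ℂ) = ((2 : ℝ) : ℂ) by norm_num, Complex.im_ofReal_mul, Complex.im_sum]
  simp only [Complex.add_im, Complex.im_ofReal_mul, Complex.ofReal_im, add_zero]

theorem summable_norm_thetaTerm {ι : Type} [Fintype ι] {τ : Matrix ι ι ℂ} {c : ℝ} (hc : 0 < c)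
    (hτ : ImCoercive τ c) (ε δ : ι → ZMod 2) (z : ι → ℂ) :
    Summable fun n => ‖thetaTerm ε δ τ z n‖ := by
  let s : ι → ℂ := fun i => (((z i).im + c * ((ε i).val : ℝ) / 2 : ℝ) : ℂ) * Complex.I
  let C : ι → ℝ := fun i =>
    Real.exp (-Real.pi * (c * (((ε i).val : ℝ) / 2) ^ 2 + ((ε i).val : ℝ) * (z i).im))
  have hsum := summable_norm_prod
    (fun i (m : ℤ) => (C i : ℂ) * jacobiTheta₂_term m (s i) ((c : ℂ) * Complex.I)) fun i => by
      have h := (summable_jacobiTheta₂_term_iff (s i) ((c : ℂ) * Complex.I)).2 (by simpa using hc)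
      exact (h.mul_left (C i : ℂ)).norm
  refine Summable.of_nonneg_of_le (fun _ => norm_nonneg _) (fun n => ?_) hsum
  rw [norm_thetaTerm, norm_prod]
  have hterm : ∀ i, ‖(C i : ℂ) * jacobiTheta₂_term (n i) (s i) ((c : ℂ) * Complex.I)‖ =
      Real.exp (-Real.pi * (c * ((n i : ℝ) + ((ε i).val : ℝ) / 2) ^ 2 +
        2 * (((n i : ℝ) + ((ε i).val : ℝ) / 2) * (z i).im))) := fun i => by
    rw [norm_mul, norm_jacobiTheta₂_term, Complex.norm_real, Real.norm_eq_abs, Real.abs_exp,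
      ← Real.exp_add]
    congr 1
    simp [s]
    ring
  simp only [hterm]
  rw [← Real.exp_sum, Real.exp_le_exp, ← Finset.mul_sum, Finset.sum_add_distrib, ← Finset.mul_sum,
    ← Finset.mul_sum]
  have := hτ fun i => (n i : ℝ) + ((ε i).val : ℝ) / 2
  nlinarith [Real.pi_pos]

theorem exists_imCoercive {ι : Type} [Fintype ι] {τ : Matrix ι ι ℂ} (hτ : τ ∈ Siegel ι) :
    ∃ c, 0 < c ∧ ImCoercive τ c := by
  rcases isEmpty_or_nonempty ι with hι | hι
  · exact ⟨1, one_pos, fun v => by simp⟩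
  let Q : EuclideanSpace ℝ ι → ℝ := fun v => ∑ i, ∑ j, v i * (τ i j).im * v j
  have hQ : Continuous Q := by fun_prop
  obtain ⟨u, hu, hmin⟩ := (isCompact_sphere (0 : EuclideanSpace ℝ ι) 1).exists_isMinOn
    (NormedSpace.sphere_nonempty.2 zero_le_one) hQ.continuousOn
  have hu1 : ‖u‖ = 1 := by simpa using hu
  have hupos : 0 < Q u := hτ.2 u fun h => by
    have : u = 0 := by ext i; simpa using congrFun h i
    simp [this] at hu1
  refine ⟨Q u, hupos, fun v => ?_⟩
  let w : EuclideanSpace ℝ ι := WithLp.toLp 2 v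
  have hw : ∑ i, v i ^ 2 = ‖w‖ ^ 2 := by
    simp [w, EuclideanSpace.norm_sq_eq]
  by_cases h0 : w = 0
  · have : v = 0 := by
      funext i
      exact congrArg (fun x : EuclideanSpace ℝ ι => x i) h0
    simp [this]
  have hpos : 0 < ‖w‖ := norm_pos_iff.2 h0
  have hmem : ‖w‖⁻¹ • w ∈ Metric.sphere (0 : EuclideanSpace ℝ ι) 1 := by
    simp [norm_smul, hpos.ne']
  have h1 : Q u ≤ Q (‖w‖⁻¹ • w) := hmin hmem
  have h2 : Q (‖w‖⁻¹ • w) = (‖w‖ ^ 2)⁻¹ * ∑ i, ∑ j, v i * (τ i j).im * v j := by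
    simp only [Q, w, Finset.mul_sum, PiLp.smul_apply, smul_eq_mul]
    refine Finset.sum_congr rfl fun i _ => Finset.sum_congr rfl fun j _ => ?_
    rw [← inv_pow]
    ring
  rw [h2, inv_mul_eq_div, le_div_iff₀ (by positivity)] at h1
  rwa [hw]

theorem eventually_imCoercive_Tmat {n : ℕ} {τ : Matrix (Fin n) (Fin n) ℂ} {c : ℝ} (hc : 0 < c)
    (hτ : ImCoercive τ c) (z : Fin n → ℂ) :
    ∃ c', 0 < c' ∧ ∀ᶠ t : ℝ in Filter.atTop, ImCoercive (Tmat t z τ) c' := by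
  refine ⟨c / 2, by positivity, ?_⟩
  filter_upwards [Filter.eventually_ge_atTop (c / 2 + 2 / c * ∑ i, (z i).im ^ 2)] with t ht v
  have hv := hτ fun i => v (Sum.inr i)
  simp only [Fintype.sum_sum_type, Finset.univ_unique, Finset.sum_singleton, Tmat,
    Matrix.fromBlocks_apply₁₁, Matrix.fromBlocks_apply₁₂, Matrix.fromBlocks_apply₂₁,
    Matrix.fromBlocks_apply₂₂, Matrix.of_apply, Finset.sum_add_distrib, Fin.default_eq_zero]
  have him : ((t : ℂ) * Complex.I).im = t := by simp
  rw [him]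
  set a := v (Sum.inl 0)
  have hsq : 0 ≤ ∑ i, (c / 2) * (v (Sum.inr i) + 2 / c * (a * (z i).im)) ^ 2 :=
    Finset.sum_nonneg fun i _ => by positivity
  have hexp : ∑ i, (c / 2) * (v (Sum.inr i) + 2 / c * (a * (z i).im)) ^ 2 =
      c / 2 * ∑ i, v (Sum.inr i) ^ 2 + 2 * ∑ i, a * (z i).im * v (Sum.inr i) +
        2 / c * (∑ i, (z i).im ^ 2) * a ^ 2 := by
    simp only [Finset.mul_sum, Finset.sum_mul, ← Finset.sum_add_distrib]
    refine Finset.sum_congr rfl fun i _ => ?_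
    field_simp
    ring
  have hcomm : ∑ i, v (Sum.inr i) * (z i).im * a = ∑ i, a * (z i).im * v (Sum.inr i) :=
    Finset.sum_congr rfl fun i _ => by ring
  rw [hcomm]
  nlinarith [mul_le_mul_of_nonneg_right ht (sq_nonneg a)]

/-- Leading coefficient, at order `m`, of a generalized power series as `q → 0⁺`. -/
theorem tendsto_inv_pow_mul_tsum (a : ℤ → ℂ) (e : ℤ → ℕ) (m : ℕ) {r : ℝ} (hr : 0 < r)
    (hsum : Summable fun k => a k * (r : ℂ) ^ e k) (hm : ∀ k, a k ≠ 0 → m ≤ e k) :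
    Filter.Tendsto (fun q : ℝ => ((q : ℂ))⁻¹ ^ m * ∑' k, a k * (q : ℂ) ^ e k)
      (nhdsWithin 0 (Set.Ioi 0)) (nhds (∑' k, if e k = m then a k else 0)) := by
  have key : ∀ q : ℝ, 0 < q → ∀ k, ((q : ℂ))⁻¹ ^ m * (a k * (q : ℂ) ^ e k) =
      a k * (q : ℂ) ^ (e k - m) := fun q hq k => by
    by_cases h : a k = 0
    · simp [h]
    have hq' : (q : ℂ) ≠ 0 := by exact_mod_cast hq.ne'
    rw [inv_pow, pow_sub₀ _ hq' (hm k h)]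
    ring
  simp only [← tsum_mul_left]
  refine tendsto_tsum_of_dominated_convergence
    (bound := fun k => ‖((r : ℂ))⁻¹ ^ m * (a k * (r : ℂ) ^ e k)‖) (hsum.mul_left _).norm ?_ ?_
  · intro k
    have h1 : Filter.Tendsto (fun q : ℝ => a k * (q : ℂ) ^ (e k - m))
        (nhdsWithin 0 (Set.Ioi 0)) (nhds (a k * ((0 : ℝ) : ℂ) ^ (e k - m))) := by
      have : Continuous fun q : ℝ => a k * (q : ℂ) ^ (e k - m) := by fun_prop
      exact (this.tendsto 0).mono_left nhdsWithin_le_nhds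
    have h2 : a k * ((0 : ℝ) : ℂ) ^ (e k - m) = if e k = m then a k else 0 := by
      by_cases h : a k = 0
      · simp [h]
      have := hm k h
      split_ifs with h'
      · simp [h']
      · rw [Complex.ofReal_zero, zero_pow (by omega), mul_zero]
    rw [← h2]
    refine h1.congr' ?_
    filter_upwards [self_mem_nhdsWithin] with q hq
    exact (key q hq k).symm
  · filter_upwards [Ioc_mem_nhdsGT hr] with q hq k
    rw [key q hq.1 k, key r hr k, norm_mul, norm_mul, norm_pow, norm_pow, Complex.norm_real,
      Complex.norm_real, Real.norm_of_nonneg hq.1.le, Real.norm_of_nonneg hr.le]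
    have := hq.1.le
    have := hq.2
    gcongr

/-- The parity sign of a characteristic, `1` for even and `-1` for odd ones. -/
def charSign {ι : Type} [Fintype ι] (ε δ : ι → ZMod 2) : ℂ :=
  Complex.exp ((Real.pi : ℂ) * Complex.I * ∑ i, ((ε i).val : ℂ) * ((δ i).val : ℂ))

theorem charSign_eq_one_or {ι : Type} [Fintype ι] (ε δ : ι → ZMod 2) :
    charSign ε δ = 1 ∨ charSign ε δ = -1 := by
  rw [← sq_eq_one_iff, charSign, ← Complex.exp_nat_mul, Complex.exp_eq_one_iff]
  refine ⟨∑ i, ((ε i).val : ℤ) * ((δ i).val : ℤ), ?_⟩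
  push_cast
  ring

theorem theta_neg {ι : Type} [Fintype ι] (ε δ : ι → ZMod 2) (τ : Matrix ι ι ℂ) (z : ι → ℂ) :
    theta ε δ τ (-z) = charSign ε δ * theta ε δ τ z := by
  rw [theta_eq_tsum, theta_eq_tsum, ← tsum_mul_left,
    ← (Equiv.subLeft fun i => -((ε i).val : ℤ)).tsum_eq]
  refine tsum_congr fun n => ?_
  rw [thetaTerm, thetaTerm, charSign, ← Complex.exp_add, Complex.exp_eq_exp_iff_exists_int]
  refine ⟨-∑ i, (n i + ((ε i).val : ℤ)) * ((δ i).val : ℤ), ?_⟩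
  have hx : ∀ i, ((((Equiv.subLeft fun i => -((ε i).val : ℤ)) n) i : ℤ) : ℂ) +
      ((ε i).val : ℂ) / 2 = -((n i : ℂ) + ((ε i).val : ℂ) / 2) := fun i => by
    simp
    ring
  simp only [hx, neg_mul, mul_neg, neg_neg, Pi.neg_apply]
  push_cast
  have hlin : 2 * ∑ i, -(((n i : ℂ) + ((ε i).val : ℂ) / 2) * (-z i + ((δ i).val : ℂ) / 2)) =
      2 * (∑ i, ((n i : ℂ) + ((ε i).val : ℂ) / 2) * (z i + ((δ i).val : ℂ) / 2)) +
        ∑ i, ((ε i).val : ℂ) * ((δ i).val : ℂ) -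
        2 * ∑ i, ((n i : ℂ) + ((ε i).val : ℂ)) * ((δ i).val : ℂ) := by
    simp only [Finset.mul_sum, ← Finset.sum_add_distrib, ← Finset.sum_sub_distrib]
    refine Finset.sum_congr rfl fun i _ => ?_
    ring
  rw [hlin]
  ring

/-- Twice the `E₈` lattice: all entries congruent modulo `2`, and sum divisible by `4`. -/
def IsDoubledE8 (u : Fin 8 → ℤ) : Prop := (∀ j, (2 : ℤ) ∣ u j - u 0) ∧ (4 : ℤ) ∣ ∑ j, u j

/-- Coordinates of twice the root exchanging `(1/2, …, 1/2)` and `(1, 1, 0, …, 0)`. -/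
def rootCoord (j : Fin 8) : ℤ := if j = 0 ∨ j = 1 then -1 else 1

open Classical in
/-- The reflection of the doubled `E₈` lattice in a root, extended by the identity. -/
def reflectE8 (u : Fin 8 → ℤ) : Fin 8 → ℤ :=
  if IsDoubledE8 u then fun j => u j - (∑ k, rootCoord k * u k) / 4 * rootCoord j else u

theorem IsDoubledE8.exists_reflect {u : Fin 8 → ℤ} (hu : IsDoubledE8 u) :
    ∃ c : ℤ, (∑ k, u k) - 2 * (u 0 + u 1) = 4 * c ∧
      reflectE8 u = fun j => u j - c * rootCoord j := by
  have hr : ∑ k, rootCoord k * u k = (∑ k, u k) - 2 * (u 0 + u 1) := by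
    simp [Fin.sum_univ_eight, rootCoord]
    ring
  obtain ⟨a, ha⟩ := hu.1 1
  obtain ⟨b, hb⟩ := hu.2
  have h4 : (∑ k, u k) - 2 * (u 0 + u 1) = 4 * (b - a - u 0) := by rw [hb]; linarith
  refine ⟨b - a - u 0, h4, ?_⟩
  rw [reflectE8, if_pos hu, hr, h4, Int.mul_ediv_cancel_left _ (by norm_num)]

theorem IsDoubledE8.reflect {u : Fin 8 → ℤ} (hu : IsDoubledE8 u) : IsDoubledE8 (reflectE8 u) := by
  obtain ⟨c, hc, h⟩ := hu.exists_reflect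
  rw [h]
  refine ⟨fun j => ?_, ?_⟩
  · have : (2 : ℤ) ∣ rootCoord j - rootCoord 0 := by
      revert j; decide
    have := (hu.1 j).sub (this.mul_left c)
    convert! this using 1
    ring
  · have : ∑ j, (u j - c * rootCoord j) = (∑ j, u j) - 4 * c := by
      simp [Fin.sum_univ_eight, rootCoord]
      ring
    rw [this]
    exact hu.2.sub (Dvd.intro _ rfl)

theorem isDoubledE8_reflect_iff (u : Fin 8 → ℤ) : IsDoubledE8 (reflectE8 u) ↔ IsDoubledE8 u := by
  refine ⟨fun h => ?_, fun h => h.reflect⟩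
  by_contra hu
  rw [reflectE8, if_neg hu] at h
  exact hu h

theorem reflectE8_involutive : Function.Involutive reflectE8 := by
  intro u
  by_cases hu : IsDoubledE8 u
  · obtain ⟨c, hc, h⟩ := hu.exists_reflect
    obtain ⟨d, hd, h'⟩ := hu.reflect.exists_reflect
    have : d = -c := by
      rw [h] at hd
      simp [Fin.sum_univ_eight, rootCoord] at hd hc
      linarith
    rw [h', h, this]
    funext j
    ring
  · have h : reflectE8 u = u := by rw [reflectE8, if_neg hu]
    rw [h, h]

theorem sum_reflectE8_mul {u v : Fin 8 → ℤ} (hu : IsDoubledE8 u) (hv : IsDoubledE8 v) :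
    ∑ j, reflectE8 u j * reflectE8 v j = ∑ j, u j * v j := by
  obtain ⟨c, hc, h⟩ := hu.exists_reflect
  obtain ⟨d, hd, h'⟩ := hv.exists_reflect
  rw [h, h']
  simp [Fin.sum_univ_eight, rootCoord] at hc hd ⊢
  linear_combination (-d) * hc - c * hd

theorem sum_reflectE8 {u : Fin 8 → ℤ} (hu : IsDoubledE8 u) :
    ∑ j, reflectE8 u j = 2 * (u 0 + u 1) := by
  obtain ⟨c, hc, h⟩ := hu.exists_reflect
  rw [h]
  simp [Fin.sum_univ_eight, rootCoord] at hc ⊢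
  linarith

/-- The general summand of the `E₈`-theta series. -/
def e8Term {ι : Type} [Fintype ι] (τ : Matrix ι ι ℂ) (Z : Fin 8 → ι → ℂ) (N : Fin 8 → ι → ℤ) : ℂ :=
  Complex.exp ((Real.pi : ℂ) * Complex.I *
    ((∑ i, ∑ i', τ i i' * ((∑ j, N j i * N j i' : ℤ) : ℂ)) / 4 + ∑ i, ∑ j, (N j i : ℂ) * Z j i))

theorem prod_thetaTerm {ι : Type} [Fintype ι] (ε δ : ι → ZMod 2) (τ : Matrix ι ι ℂ)
    (Z : Fin 8 → ι → ℂ) (n : Fin 8 → ι → ℤ) :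
    ∏ j, thetaTerm ε δ τ (Z j) (n j) = e8Term τ Z (fun j i => 2 * n j i + ((ε i).val : ℤ)) *
      ∏ i, Complex.exp ((Real.pi : ℂ) * Complex.I * ((∑ j, n j i : ℤ) * ((δ i).val : ℂ))) := by
  simp only [thetaTerm, e8Term]
  rw [← Complex.exp_sum, ← Complex.exp_sum, ← Complex.exp_add, Complex.exp_eq_exp_iff_exists_int]
  refine ⟨∑ i, 2 * ((ε i).val : ℤ) * ((δ i).val : ℤ), ?_⟩
  have hquad : ∑ j, ∑ i, ∑ i', ((n j i : ℂ) + ((ε i).val : ℂ) / 2) * τ i i' *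
      ((n j i' : ℂ) + ((ε i').val : ℂ) / 2) =
      (∑ i, ∑ i', τ i i' * ((∑ j, (2 * n j i + ((ε i).val : ℤ)) *
        (2 * n j i' + ((ε i').val : ℤ)) : ℤ) : ℂ)) / 4 := by
    rw [Finset.sum_comm, Finset.sum_div]
    refine Finset.sum_congr rfl fun i _ => ?_
    rw [Finset.sum_comm, Finset.sum_div]
    refine Finset.sum_congr rfl fun i' _ => ?_
    push_cast
    rw [Finset.mul_sum, Finset.sum_div]
    refine Finset.sum_congr rfl fun j _ => ?_
    ring
  have hlin : ∑ j, 2 * ∑ i, ((n j i : ℂ) + ((ε i).val : ℂ) / 2) * (Z j i + ((δ i).val : ℂ) / 2) =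
      ∑ i, ∑ j, ((2 * n j i + ((ε i).val : ℤ) : ℤ) : ℂ) * Z j i +
        ∑ i, ((∑ j, n j i : ℤ) : ℂ) * ((δ i).val : ℂ) +
        2 * ∑ i, 2 * ((ε i).val : ℂ) * ((δ i).val : ℂ) := by
    rw [← Finset.mul_sum, Finset.sum_comm, Finset.mul_sum, Finset.mul_sum,
      ← Finset.sum_add_distrib, ← Finset.sum_add_distrib]
    refine Finset.sum_congr rfl fun i _ => ?_
    simp only [Fin.sum_univ_eight]
    push_cast
    ring
  rw [← Finset.mul_sum, Finset.sum_add_distrib, hquad, hlin, ← Finset.mul_sum]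
  push_cast
  ring

theorem sum_zmod_two {M : Type*} [AddCommMonoid M] (f : ZMod 2 → M) : ∑ d, f d = f 0 + f 1 :=
  Fin.sum_univ_two f

theorem sum_prod_exp_pi_mul {ι : Type} [Fintype ι] [DecidableEq ι] (s : ι → ℤ) :
    ∑ δ : ι → ZMod 2, ∏ i, Complex.exp ((Real.pi : ℂ) * Complex.I * ((s i : ℂ) * ((δ i).val : ℂ))) =
      if ∀ i, (2 : ℤ) ∣ s i then (2 : ℂ) ^ Fintype.card ι else 0 := by
  rw [← Fintype.prod_sum (f := fun i (d : ZMod 2) =>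
    Complex.exp ((Real.pi : ℂ) * Complex.I * ((s i : ℂ) * (d.val : ℂ))))]
  have h : ∀ i, ∑ d : ZMod 2, Complex.exp ((Real.pi : ℂ) * Complex.I * ((s i : ℂ) * (d.val : ℂ))) =
      if (2 : ℤ) ∣ s i then 2 else 0 := fun i => by
    have h2 : ∑ d : ZMod 2, Complex.exp ((Real.pi : ℂ) * Complex.I * ((s i : ℂ) * (d.val : ℂ))) =
        1 + Complex.exp ((s i : ℂ) * ((Real.pi : ℂ) * Complex.I)) := by
      rw [sum_zmod_two, ZMod.val_zero, ZMod.val_one]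
      simp [mul_comm]
    rw [h2, Complex.exp_int_mul, Complex.exp_pi_mul_I]
    split_ifs with hd
    · rw [Even.neg_one_zpow (even_iff_two_dvd.2 hd)]
      norm_num
    · rw [Odd.neg_one_zpow (Int.not_even_iff_odd.1 fun h => hd (even_iff_two_dvd.1 h))]
      norm_num
  simp only [h]
  split_ifs with hs
  · simp [hs]
  · push Not at hs
    obtain ⟨i, hi⟩ := hs
    exact Finset.prod_eq_zero (Finset.mem_univ i) (if_neg hi)

open Classical in
theorem sum_prod_theta {ι : Type} [Fintype ι] [DecidableEq ι] {τ : Matrix ι ι ℂ} {c : ℝ}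
    (hc : 0 < c) (hτ : ImCoercive τ c) (Z : Fin 8 → ι → ℂ) :
    ∑ ε : ι → ZMod 2, ∑ δ : ι → ZMod 2, ∏ j, theta ε δ τ (Z j) =
      (2 : ℂ) ^ Fintype.card ι * ∑' N : Fin 8 → ι → ℤ,
        if ∀ i, IsDoubledE8 fun j => N j i then e8Term τ Z N else 0 := by
  set f : (Fin 8 → ι → ℤ) → ℂ := fun N =>
    if ∀ i, IsDoubledE8 fun j => N j i then e8Term τ Z N else 0
  let G : (ι → ZMod 2) × (Fin 8 → ι → ℤ) → Fin 8 → ι → ℤ :=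
    fun p j i => 2 * p.2 j i + ((p.1 i).val : ℤ)
  have hsummable : ∀ ε δ : ι → ZMod 2,
      Summable fun n : Fin 8 → ι → ℤ => ∏ j, thetaTerm ε δ τ (Z j) (n j) := fun ε δ =>
    (summable_norm_and_tsum_prod_fin 8 (fun j => thetaTerm ε δ τ (Z j))
      fun j => summable_norm_thetaTerm hc hτ ε δ (Z j)).1.of_norm
  have hiff : ∀ p : (ι → ZMod 2) × (Fin 8 → ι → ℤ),
      (∀ i, IsDoubledE8 fun j => G p j i) ↔ ∀ i, (2 : ℤ) ∣ ∑ j, p.2 j i := fun p => by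
    refine forall_congr' fun i => ?_
    simp only [IsDoubledE8, G]
    have h1 : ∀ j : Fin 8, (2 : ℤ) ∣ 2 * p.2 j i + ((p.1 i).val : ℤ) -
        (2 * p.2 0 i + ((p.1 i).val : ℤ)) := fun j => ⟨p.2 j i - p.2 0 i, by ring⟩
    simp only [h1, implies_true, true_and, Fin.sum_univ_eight]
    omega
  have hδ : ∀ (ε : ι → ZMod 2) (n : Fin 8 → ι → ℤ),
      ∑ δ : ι → ZMod 2, ∏ j, thetaTerm ε δ τ (Z j) (n j) =
        (2 : ℂ) ^ Fintype.card ι * f (G (ε, n)) := fun ε n => by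
    simp only [prod_thetaTerm]
    rw [← Finset.mul_sum, sum_prod_exp_pi_mul]
    simp only [f, hiff]
    split_ifs
    · exact mul_comm _ _
    · simp
  have hε : ∀ ε : ι → ZMod 2, Summable fun n => f (G (ε, n)) := fun ε => by
    have h := summable_sum (s := Finset.univ) fun δ _ => hsummable ε δ
    simp only [hδ] at h
    exact (summable_mul_left_iff (pow_ne_zero _ two_ne_zero)).1 h
  have hprod : Summable fun p => f (G p) := by
    rw [← summable_norm_iff, summable_prod_of_nonneg fun _ => norm_nonneg _]
    exact ⟨fun ε => (hε ε).norm, (hasSum_fintype _).summable⟩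
  have hinj : Function.Injective G := fun p p' h => by
    have hp : ∀ j i, 2 * p.2 j i + ((p.1 i).val : ℤ) = 2 * p'.2 j i + ((p'.1 i).val : ℤ) :=
      fun j i => congrFun (congrFun h j) i
    have hval : ∀ i, (p.1 i).val = (p'.1 i).val := fun i => by
      have := hp 0 i
      have := ZMod.val_lt (p.1 i)
      have := ZMod.val_lt (p'.1 i)
      omega
    refine Prod.ext (funext fun i => ZMod.val_injective 2 (hval i)) ?_
    funext j i
    have := hp j i
    have := hval i
    omega
  have hsupp : Function.support f ⊆ Set.range G := fun N hN => by
    have hgood : ∀ i, IsDoubledE8 fun j => N j i := by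
      by_contra h
      exact hN (if_neg h)
    refine ⟨(fun i => ((N 0 i : ℤ) : ZMod 2), fun j i => N j i / 2), ?_⟩
    funext j i
    have h : (2 : ℤ) ∣ N j i - N 0 i := (hgood i).1 j
    simp only [G, ZMod.val_intCast]
    omega
  rw [← hinj.tsum_eq hsupp, hprod.tsum_prod, tsum_fintype, Finset.mul_sum]
  refine Finset.sum_congr rfl fun ε _ => ?_
  rw [← tsum_mul_left]
  simp only [← hδ]
  rw [Summable.tsum_finsetSum fun δ _ => hsummable ε δ]
  refine Finset.sum_congr rfl fun δ _ => ?_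
  exact (summable_norm_and_tsum_prod_fin 8 (fun j => thetaTerm ε δ τ (Z j))
      fun j => summable_norm_thetaTerm hc hτ ε δ (Z j)).2

/-- A Riemann-type identity, from a reflection of the `E₈` lattice. -/
theorem sum_theta_half_pow_eight {ι : Type} [Fintype ι] [DecidableEq ι] {τ : Matrix ι ι ℂ} {c : ℝ}
    (hc : 0 < c) (hτ : ImCoercive τ c) (w : ι → ℂ) :
    ∑ ε : ι → ZMod 2, ∑ δ : ι → ZMod 2, theta ε δ τ ((1 / 2 : ℂ) • w) ^ 8 =
      ∑ ε : ι → ZMod 2, ∑ δ : ι → ZMod 2, theta ε δ τ 0 ^ 6 * theta ε δ τ w ^ 2 := by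
  classical
  have hL := sum_prod_theta hc hτ fun _ => (1 / 2 : ℂ) • w
  have hR := sum_prod_theta hc hτ fun j => if j = 0 ∨ j = 1 then w else 0
  have h8 : ∀ ε δ, ∏ j : Fin 8, theta ε δ τ (if j = 0 ∨ j = 1 then w else 0) =
      theta ε δ τ 0 ^ 6 * theta ε δ τ w ^ 2 := fun ε δ => by
    simp [Fin.prod_univ_eight]
    ring
  simp only [Finset.prod_const, Finset.card_univ, Fintype.card_fin] at hL
  simp only [h8] at hR
  rw [hL, hR]
  congr 1
  let R : (Fin 8 → ι → ℤ) → Fin 8 → ι → ℤ := fun N j i => reflectE8 (fun k => N k i) j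
  have hR : Function.Involutive R := fun N => by
    funext j i
    exact congrFun (reflectE8_involutive fun k => N k i) j
  rw [← (hR.toPerm).tsum_eq]
  refine tsum_congr fun N => ?_
  have hcol : ∀ i, (IsDoubledE8 fun j => R N j i) ↔ IsDoubledE8 fun j => N j i := fun i =>
    isDoubledE8_reflect_iff fun j => N j i
  simp only [Function.Involutive.coe_toPerm, hcol]
  split_ifs with hN
  · rw [e8Term, e8Term]
    have hq : ∀ i i', ∑ j, R N j i * R N j i' = ∑ j, N j i * N j i' := fun i i' =>
      sum_reflectE8_mul (hN i) (hN i')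
    have hl : ∀ i, ∑ j, (R N j i : ℂ) * ((1 / 2 : ℂ) • w) i =
        ∑ j, (N j i : ℂ) * (if j = 0 ∨ j = 1 then w else 0 : ι → ℂ) i := fun i => by
      have h := congrArg (Int.cast : ℤ → ℂ) (sum_reflectE8 (hN i))
      push_cast at h
      rw [← Finset.sum_mul]
      change (∑ j, ((reflectE8 (fun k => N k i) j : ℤ) : ℂ)) * _ = _
      rw [h]
      simp [Fin.sum_univ_eight]
      ring
    simp only [hq, hl]
  · rfl

theorem qdeg_pow (t : ℝ) (k : ℤ) (d : ℕ) :
    (qdeg t : ℂ) ^ ((2 * k + (d : ℤ)).natAbs ^ 2) =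
      Complex.exp ((Real.pi : ℂ) * Complex.I *
        ((t : ℂ) * Complex.I * ((k : ℂ) + (d : ℂ) / 2) ^ 2)) := by
  have h : (((2 * k + (d : ℤ)).natAbs ^ 2 : ℕ) : ℂ) = (2 * (k : ℂ) + (d : ℂ)) ^ 2 := by
    have : (((2 * k + (d : ℤ)).natAbs ^ 2 : ℕ) : ℤ) = (2 * k + (d : ℤ)) ^ 2 := by
      push_cast
      exact sq_abs _
    rw [← Int.cast_natCast, this]
    push_cast
    rfl
  rw [qdeg, Complex.ofReal_exp, ← Complex.exp_nat_mul, h]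
  congr 1
  push_cast
  linear_combination (-(Real.pi : ℂ) * t * ((k : ℂ) + (d : ℂ) / 2) ^ 2) * Complex.I_sq

theorem thetaTerm_Tmat {n : ℕ} (τ : Matrix (Fin n) (Fin n) ℂ) (z : Fin n → ℂ) (t : ℝ)
    (ε₁ δ₁ : ZMod 2) (ε δ : Fin n → ZMod 2) (k : ℤ) (N : Fin n → ℤ) :
    thetaTerm (extChar ε₁ δ₁ ε δ).1 (extChar ε₁ δ₁ ε δ).2 (Tmat t z τ) 0
        (Sum.elim (fun _ => k) N) =
      Complex.exp ((Real.pi : ℂ) * Complex.I * (((k : ℂ) + (ε₁.val : ℂ) / 2) * (δ₁.val : ℂ))) *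
        (qdeg t : ℂ) ^ ((2 * k + (ε₁.val : ℤ)).natAbs ^ 2) *
        thetaTerm ε δ τ (((k : ℂ) + (ε₁.val : ℂ) / 2) • z) N := by
  rw [qdeg_pow, thetaTerm, thetaTerm, ← Complex.exp_add, ← Complex.exp_add]
  congr 1
  simp only [Fintype.sum_sum_type, Finset.univ_unique, Finset.sum_singleton, Tmat, extChar,
    Matrix.fromBlocks_apply₁₁, Matrix.fromBlocks_apply₁₂, Matrix.fromBlocks_apply₂₁,
    Matrix.fromBlocks_apply₂₂, Matrix.of_apply, Finset.sum_add_distrib, Sum.elim_inl, Sum.elim_inr,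
    Pi.zero_apply, Pi.smul_apply, smul_eq_mul, zero_add]
  set κ : ℂ := (k : ℂ) + (ε₁.val : ℂ) / 2
  have h1 : ∑ j, κ * z j * ((N j : ℂ) + ((ε j).val : ℂ) / 2) =
      ∑ j, ((N j : ℂ) + ((ε j).val : ℂ) / 2) * (κ * z j) :=
    Finset.sum_congr rfl fun j _ => by ring
  have h2 : ∑ j, ((N j : ℂ) + ((ε j).val : ℂ) / 2) * z j * κ =
      ∑ j, ((N j : ℂ) + ((ε j).val : ℂ) / 2) * (κ * z j) :=
    Finset.sum_congr rfl fun j _ => by ring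
  have h3 : ∑ j, ((N j : ℂ) + ((ε j).val : ℂ) / 2) * (κ * z j + ((δ j).val : ℂ) / 2) =
      ∑ j, ((N j : ℂ) + ((ε j).val : ℂ) / 2) * (κ * z j) +
        ∑ j, ((N j : ℂ) + ((ε j).val : ℂ) / 2) * (((δ j).val : ℂ) / 2) := by
    rw [← Finset.sum_add_distrib]
    exact Finset.sum_congr rfl fun j _ => by ring
  rw [h1, h2, h3]
  ring

/-- Fourier–Jacobi expansion of a theta constant of genus `n + 1`. -/
theorem thetaConst_Tmat {n : ℕ} {τ : Matrix (Fin n) (Fin n) ℂ} {z : Fin n → ℂ} {t c : ℝ}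
    (hc : 0 < c) (hT : ImCoercive (Tmat t z τ) c) (ε₁ δ₁ : ZMod 2) (ε δ : Fin n → ZMod 2) :
    HasSum (fun k : ℤ => Complex.exp ((Real.pi : ℂ) * Complex.I *
        (((k : ℂ) + (ε₁.val : ℂ) / 2) * (δ₁.val : ℂ))) *
          theta ε δ τ (((k : ℂ) + (ε₁.val : ℂ) / 2) • z) *
        (qdeg t : ℂ) ^ ((2 * k + (ε₁.val : ℤ)).natAbs ^ 2))
      (thetaConst (extChar ε₁ δ₁ ε δ) (Tmat t z τ)) := by
  let e : ℤ × (Fin n → ℤ) ≃ (Fin 1 ⊕ Fin n → ℤ) :=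
    ((Equiv.funUnique (Fin 1) ℤ).symm.prodCongr (Equiv.refl _)).trans
      (Equiv.sumArrowEquivProdArrow (Fin 1) (Fin n) ℤ).symm
  have he : ∀ p, e p = Sum.elim (fun _ => p.1) p.2 := fun p => rfl
  have hs := (summable_norm_thetaTerm hc hT (extChar ε₁ δ₁ ε δ).1 (extChar ε₁ δ₁ ε δ).2 0).of_norm
  rw [← e.summable_iff] at hs
  have h := hs.prod.hasSum
  rw [← hs.tsum_prod] at h
  simp only [Function.comp_apply] at h
  rw [e.tsum_eq] at h
  convert! h using 2 with k
  simp only [he, thetaTerm_Tmat]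
  rw [tsum_mul_left, theta_eq_tsum]
  ring

theorem qdeg_pos (t : ℝ) : 0 < qdeg t := Real.exp_pos _

theorem tendsto_qdeg : Filter.Tendsto qdeg Filter.atTop (nhdsWithin 0 (Set.Ioi 0)) := by
  refine tendsto_nhdsWithin_iff.2 ⟨?_, Filter.Eventually.of_forall qdeg_pos⟩
  refine Real.tendsto_exp_atBot.comp ?_
  have h : (fun t : ℝ => -Real.pi * t / 4) = fun t => (-Real.pi / 4) * t := by
    funext t
    ring
  rw [h]
  exact Filter.tendsto_id.const_mul_atTop_of_neg (by linarith [Real.pi_pos])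

theorem tendsto_qdeg_inv_pow_mul {F : ℝ → ℂ} (a : ℤ → ℂ) (e : ℤ → ℕ) (m : ℕ)
    (hF : ∀ᶠ t in Filter.atTop, HasSum (fun k => a k * (qdeg t : ℂ) ^ e k) (F t))
    (hm : ∀ k, a k ≠ 0 → m ≤ e k) :
    Filter.Tendsto (fun t => ((qdeg t : ℂ))⁻¹ ^ m * F t) Filter.atTop
      (nhds (∑' k, if e k = m then a k else 0)) := by
  obtain ⟨t₀, ht₀⟩ := hF.exists
  refine ((tendsto_inv_pow_mul_tsum a e m (qdeg_pos t₀) ht₀.summable hm).comp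
    tendsto_qdeg).congr' ?_
  filter_upwards [hF] with t ht
  simp only [Function.comp_apply, ht.tsum_eq]

section Expansion

variable {n : ℕ} {τ : Matrix (Fin n) (Fin n) ℂ} {z : Fin n → ℂ} {t c : ℝ}

theorem hasSum_thetaConst_zero_zero (hc : 0 < c) (hT : ImCoercive (Tmat t z τ) c)
    (ε δ : Fin n → ZMod 2) :
    HasSum (fun k : ℤ => theta ε δ τ ((k : ℂ) • z) * (qdeg t : ℂ) ^ ((2 * k).natAbs ^ 2))
      (thetaConst (extChar 0 0 ε δ) (Tmat t z τ)) := by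
  simpa using thetaConst_Tmat hc hT 0 0 ε δ

theorem hasSum_thetaConst_zero_one (hc : 0 < c) (hT : ImCoercive (Tmat t z τ) c)
    (ε δ : Fin n → ZMod 2) :
    HasSum (fun k : ℤ => (-1) ^ k * theta ε δ τ ((k : ℂ) • z) *
        (qdeg t : ℂ) ^ ((2 * k).natAbs ^ 2))
      (thetaConst (extChar 0 1 ε δ) (Tmat t z τ)) := by
  convert! thetaConst_Tmat hc hT 0 1 ε δ using 2 with k
  have h : Complex.exp ((Real.pi : ℂ) * Complex.I * (k : ℂ)) = (-1) ^ k := by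
    rw [mul_comm, Complex.exp_int_mul, Complex.exp_pi_mul_I]
  simp [ZMod.val_one, h]

theorem hasSum_thetaConst_one_zero (hc : 0 < c) (hT : ImCoercive (Tmat t z τ) c)
    (ε δ : Fin n → ZMod 2) :
    HasSum (fun k : ℤ => theta ε δ τ (((k : ℂ) + 1 / 2) • z) *
        (qdeg t : ℂ) ^ ((2 * k + 1).natAbs ^ 2))
      (thetaConst (extChar 1 0 ε δ) (Tmat t z τ)) := by
  simpa [ZMod.val_one] using thetaConst_Tmat hc hT 1 0 ε δ

theorem hasSum_thetaConst_one_one (hc : 0 < c) (hT : ImCoercive (Tmat t z τ) c)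
    (ε δ : Fin n → ZMod 2) :
    HasSum (fun k : ℤ => (-1) ^ k * Complex.I * theta ε δ τ (((k : ℂ) + 1 / 2) • z) *
        (qdeg t : ℂ) ^ ((2 * k + 1).natAbs ^ 2))
      (thetaConst (extChar 1 1 ε δ) (Tmat t z τ)) := by
  convert! thetaConst_Tmat hc hT 1 1 ε δ using 2 with k
  have h : Complex.exp ((Real.pi : ℂ) * Complex.I * ((k : ℂ) + 1 / 2)) = (-1) ^ k * Complex.I := by
    rw [mul_add, Complex.exp_add, mul_comm _ (k : ℂ), Complex.exp_int_mul, Complex.exp_pi_mul_I,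
      show (Real.pi : ℂ) * Complex.I * (1 / 2) = (Real.pi : ℂ) / 2 * Complex.I by ring,
      Complex.exp_pi_div_two_mul_I]
  simp only [ZMod.val_one, Nat.cast_one, mul_one, h]

end Expansion

section Limits

variable {n : ℕ} {τ : Matrix (Fin n) (Fin n) ℂ} {z : Fin n → ℂ} {c : ℝ}

theorem tendsto_thetaConst_add (hc : 0 < c)
    (hT : ∀ᶠ t : ℝ in Filter.atTop, ImCoercive (Tmat t z τ) c) (ε δ : Fin n → ZMod 2) :
    Filter.Tendsto (fun t => ((qdeg t : ℂ))⁻¹ ^ 8 *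
        (thetaConst (extChar 0 0 ε δ) (Tmat t z τ) + thetaConst (extChar 0 1 ε δ) (Tmat t z τ) -
          2 * theta ε δ τ 0)) Filter.atTop (nhds 0) := by
  have h := tendsto_qdeg_inv_pow_mul (F := fun t => thetaConst (extChar 0 0 ε δ) (Tmat t z τ) +
      thetaConst (extChar 0 1 ε δ) (Tmat t z τ) - 2 * theta ε δ τ 0)
    (fun k : ℤ => (1 + (-1) ^ k) * theta ε δ τ ((k : ℂ) • z) -
      if k = 0 then 2 * theta ε δ τ 0 else 0) (fun k => (2 * k).natAbs ^ 2) 8 ?_ ?_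
  · have h8 : ∀ k : ℤ, (2 * k).natAbs ^ 2 ≠ 8 := fun k hk => by
      have : (2 * k).natAbs ≤ 3 := by nlinarith
      interval_cases (2 * k).natAbs <;> omega
    simpa only [h8, if_false, tsum_zero] using h
  · filter_upwards [hT] with t ht
    convert! ((hasSum_thetaConst_zero_zero hc ht ε δ).add
      (hasSum_thetaConst_zero_one hc ht ε δ)).sub
        (hasSum_ite_eq (0 : ℤ) (2 * theta ε δ τ 0)) using 2 with k
    split_ifs with hk
    · simp [hk]
      ring
    · ring
  · intro k hk
    by_contra hlt
    apply hk
    have hk1 : (2 * k).natAbs ≤ 2 := by nlinarith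
    obtain rfl | rfl | rfl : k = -1 ∨ k = 0 ∨ k = 1 := by omega
    · simp
    · simp
      ring
    · simp

theorem tendsto_thetaConst_sub (hc : 0 < c)
    (hT : ∀ᶠ t : ℝ in Filter.atTop, ImCoercive (Tmat t z τ) c) (ε δ : Fin n → ZMod 2) :
    Filter.Tendsto (fun t => ((qdeg t : ℂ))⁻¹ ^ 4 *
        (thetaConst (extChar 0 0 ε δ) (Tmat t z τ) - thetaConst (extChar 0 1 ε δ) (Tmat t z τ)))
      Filter.atTop (nhds (2 * (theta ε δ τ z + theta ε δ τ (-z)))) := by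
  have h := tendsto_qdeg_inv_pow_mul (F := fun t => thetaConst (extChar 0 0 ε δ) (Tmat t z τ) -
      thetaConst (extChar 0 1 ε δ) (Tmat t z τ))
    (fun k : ℤ => (1 - (-1) ^ k) * theta ε δ τ ((k : ℂ) • z)) (fun k => (2 * k).natAbs ^ 2) 4 ?_ ?_
  · convert! h using 2
    rw [tsum_eq_sum (s := {1, -1})]
    · rw [Finset.sum_pair (by norm_num)]
      norm_num
      ring
    · intro k hk
      refine if_neg fun h4 => hk ?_
      have : (2 * k).natAbs = 2 := (Nat.pow_left_inj two_ne_zero).1 (h4.trans (by norm_num))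
      simp only [Finset.mem_insert, Finset.mem_singleton]
      omega
  · filter_upwards [hT] with t ht
    convert! (hasSum_thetaConst_zero_zero hc ht ε δ).sub
      (hasSum_thetaConst_zero_one hc ht ε δ) using 2 with k
    ring
  · intro k hk
    have hk0 : k ≠ 0 := by
      rintro rfl
      simp at hk
    have : 2 ≤ (2 * k).natAbs := by omega
    nlinarith

theorem tsum_ite_natAbs_odd_eq_one (a : ℤ → ℂ) :
    (∑' k : ℤ, if (2 * k + 1).natAbs ^ 2 = 1 then a k else 0) = a 0 + a (-1) := by
  rw [tsum_eq_sum (s := {0, -1})]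
  · rw [Finset.sum_pair (by norm_num)]
    norm_num
  · intro k hk
    refine if_neg fun h1 => hk ?_
    have : (2 * k + 1).natAbs = 1 := (Nat.pow_left_inj two_ne_zero).1 (h1.trans (by norm_num))
    simp only [Finset.mem_insert, Finset.mem_singleton]
    omega

theorem one_le_natAbs_odd_sq (k : ℤ) : 1 ≤ (2 * k + 1).natAbs ^ 2 :=
  Nat.one_le_pow _ _ (by omega)

theorem tendsto_thetaConst_one_zero (hc : 0 < c)
    (hT : ∀ᶠ t : ℝ in Filter.atTop, ImCoercive (Tmat t z τ) c) (ε δ : Fin n → ZMod 2) :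
    Filter.Tendsto (fun t => ((qdeg t : ℂ))⁻¹ * thetaConst (extChar 1 0 ε δ) (Tmat t z τ))
      Filter.atTop
      (nhds (theta ε δ τ ((1 / 2 : ℂ) • z) + theta ε δ τ (-((1 / 2 : ℂ) • z)))) := by
  have h := tendsto_qdeg_inv_pow_mul (F := fun t => thetaConst (extChar 1 0 ε δ) (Tmat t z τ))
    _ _ 1 (by filter_upwards [hT] with t ht using hasSum_thetaConst_one_zero hc ht ε δ)
    fun k _ => one_le_natAbs_odd_sq k
  rw [tsum_ite_natAbs_odd_eq_one] at h
  convert! h using 2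
  · rw [pow_one]
  · rw [← neg_smul]
    norm_num

theorem tendsto_thetaConst_one_one (hc : 0 < c)
    (hT : ∀ᶠ t : ℝ in Filter.atTop, ImCoercive (Tmat t z τ) c) (ε δ : Fin n → ZMod 2) :
    Filter.Tendsto (fun t => ((qdeg t : ℂ))⁻¹ * thetaConst (extChar 1 1 ε δ) (Tmat t z τ))
      Filter.atTop
      (nhds (Complex.I *
        (theta ε δ τ ((1 / 2 : ℂ) • z) - theta ε δ τ (-((1 / 2 : ℂ) • z))))) := by
  have h := tendsto_qdeg_inv_pow_mul (F := fun t => thetaConst (extChar 1 1 ε δ) (Tmat t z τ))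
    _ _ 1 (by filter_upwards [hT] with t ht using hasSum_thetaConst_one_one hc ht ε δ)
    fun k _ => one_le_natAbs_odd_sq k
  rw [tsum_ite_natAbs_odd_eq_one] at h
  convert! h using 2
  · rw [pow_one]
  · rw [← neg_smul]
    norm_num
    ring

end Limits

section PowerSums

variable {α : Type*} {l : Filter α} {q x y : α → ℂ} {θ s : ℂ}

/-- If `(x + y) / 2 = θ + o(q⁸)` and `(x - y) / 2 ∼ s q⁴`, this is the `q⁸`-coefficient of
`x ^ 8 + y ^ 8`. -/
theorem tendsto_pow_eight_add_pow_eight (hq0 : ∀ a, q a ≠ 0)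
    (hq : Filter.Tendsto q l (nhds 0))
    (hadd : Filter.Tendsto (fun a => (q a)⁻¹ ^ 8 * (x a + y a - 2 * θ)) l (nhds 0))
    (hsub : Filter.Tendsto (fun a => (q a)⁻¹ ^ 4 * (x a - y a)) l (nhds (2 * s))) :
    Filter.Tendsto (fun a => (q a)⁻¹ ^ 8 * (x a ^ 8 + y a ^ 8 - 2 * θ ^ 8)) l
      (nhds (56 * (θ ^ 6 * s ^ 2))) := by
  let R : ℂ × ℂ × ℂ → ℂ := fun w =>
    (fun P v => 2 * w.2.1 * ((P + θ) * (P ^ 2 + θ ^ 2) * (P ^ 4 + θ ^ 4)) +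
      2 * (28 * P ^ 6 * v ^ 2 + w.1 ^ 8 * (70 * P ^ 4 * v ^ 4 + 28 * P ^ 2 * w.1 ^ 8 * v ^ 6 +
        w.1 ^ 16 * v ^ 8))) (θ + w.1 ^ 8 * w.2.1) w.2.2
  have hR : Continuous R := by fun_prop
  have hlim := (hR.tendsto (0, 0, s)).comp
    (hq.prodMk_nhds ((by simpa using hadd.div_const 2 :
      Filter.Tendsto (fun a => (q a)⁻¹ ^ 8 * (x a + y a - 2 * θ) / 2) l (nhds 0)).prodMk_nhds
      (by simpa using hsub.div_const 2 :
        Filter.Tendsto (fun a => (q a)⁻¹ ^ 4 * (x a - y a) / 2) l (nhds s))))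
  have hval : R (0, 0, s) = 56 * (θ ^ 6 * s ^ 2) := by
    simp only [R]
    ring
  rw [hval] at hlim
  refine hlim.congr fun a => ?_
  simp only [Function.comp_apply, R]
  have h0 := hq0 a
  obtain ⟨h, hh⟩ : ∃ h, h = (q a)⁻¹ ^ 8 * (x a + y a - 2 * θ) / 2 := ⟨_, rfl⟩
  obtain ⟨v, hv⟩ : ∃ v, v = (q a)⁻¹ ^ 4 * (x a - y a) / 2 := ⟨_, rfl⟩
  have hx : x a = θ + q a ^ 8 * h + q a ^ 4 * v := by
    rw [hh, hv]; field_simp; ring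
  have hy : y a = θ + q a ^ 8 * h - q a ^ 4 * v := by
    rw [hh, hv]; field_simp; ring
  rw [← hh, ← hv, hx, hy, inv_pow, eq_inv_mul_iff_mul_eq₀ (pow_ne_zero 8 h0)]
  obtain ⟨P, hP⟩ : ∃ P, P = θ + q a ^ 8 * h := ⟨_, rfl⟩
  rw [← hP]
  linear_combination
    (-2 * ((P + θ) * (P ^ 2 + θ ^ 2) * (P ^ 4 + θ ^ 4))) * hP

/-- If `(x + y) / 2 = θ + o(q⁸)` and `(x - y) / 2 ∼ s q⁴`, this is the `q⁸`-coefficient of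
`x ^ 16 + y ^ 16`. -/
theorem tendsto_pow_sixteen_add_pow_sixteen (hq0 : ∀ a, q a ≠ 0)
    (hq : Filter.Tendsto q l (nhds 0))
    (hadd : Filter.Tendsto (fun a => (q a)⁻¹ ^ 8 * (x a + y a - 2 * θ)) l (nhds 0))
    (hsub : Filter.Tendsto (fun a => (q a)⁻¹ ^ 4 * (x a - y a)) l (nhds (2 * s))) :
    Filter.Tendsto (fun a => (q a)⁻¹ ^ 8 * (x a ^ 16 + y a ^ 16 - 2 * θ ^ 16)) l
      (nhds (240 * (θ ^ 14 * s ^ 2))) := by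
  let R : ℂ × ℂ × ℂ → ℂ := fun w =>
    (fun P v => 2 * w.2.1 * ((P + θ) * (P ^ 2 + θ ^ 2) * (P ^ 4 + θ ^ 4) * (P ^ 8 + θ ^ 8)) +
      2 * (120 * P ^ 14 * v ^ 2 + w.1 ^ 8 * (1820 * P ^ 12 * v ^ 4 +
        8008 * P ^ 10 * w.1 ^ 8 * v ^ 6 + 12870 * P ^ 8 * w.1 ^ 16 * v ^ 8 +
        8008 * P ^ 6 * w.1 ^ 24 * v ^ 10 + 1820 * P ^ 4 * w.1 ^ 32 * v ^ 12 +
        120 * P ^ 2 * w.1 ^ 40 * v ^ 14 + w.1 ^ 48 * v ^ 16))) (θ + w.1 ^ 8 * w.2.1) w.2.2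
  have hR : Continuous R := by fun_prop
  have hlim := (hR.tendsto (0, 0, s)).comp
    (hq.prodMk_nhds ((by simpa using hadd.div_const 2 :
      Filter.Tendsto (fun a => (q a)⁻¹ ^ 8 * (x a + y a - 2 * θ) / 2) l (nhds 0)).prodMk_nhds
      (by simpa using hsub.div_const 2 :
        Filter.Tendsto (fun a => (q a)⁻¹ ^ 4 * (x a - y a) / 2) l (nhds s))))
  have hval : R (0, 0, s) = 240 * (θ ^ 14 * s ^ 2) := by
    simp only [R]
    ring
  rw [hval] at hlim
  refine hlim.congr fun a => ?_
  simp only [Function.comp_apply, R]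
  have h0 := hq0 a
  obtain ⟨h, hh⟩ : ∃ h, h = (q a)⁻¹ ^ 8 * (x a + y a - 2 * θ) / 2 := ⟨_, rfl⟩
  obtain ⟨v, hv⟩ : ∃ v, v = (q a)⁻¹ ^ 4 * (x a - y a) / 2 := ⟨_, rfl⟩
  have hx : x a = θ + q a ^ 8 * h + q a ^ 4 * v := by
    rw [hh, hv]; field_simp; ring
  have hy : y a = θ + q a ^ 8 * h - q a ^ 4 * v := by
    rw [hh, hv]; field_simp; ring
  rw [← hh, ← hv, hx, hy, inv_pow, eq_inv_mul_iff_mul_eq₀ (pow_ne_zero 8 h0)]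
  obtain ⟨P, hP⟩ : ∃ P, P = θ + q a ^ 8 * h := ⟨_, rfl⟩
  rw [← hP]
  linear_combination
    (-2 * ((P + θ) * (P ^ 2 + θ ^ 2) * (P ^ 4 + θ ^ 4) * (P ^ 8 + θ ^ 8))) * hP

end PowerSums

theorem sum_zmod_two_sum_arrow {n : ℕ} {M : Type*} [AddCommMonoid M]
    (f : (Fin 1 ⊕ Fin n → ZMod 2) → M) :
    ∑ x, f x = ∑ d : ZMod 2, ∑ y : Fin n → ZMod 2, f (Sum.elim (fun _ => d) y) := by
  rw [← Fintype.sum_prod_type' fun (d : ZMod 2) (y : Fin n → ZMod 2) => f (Sum.elim (fun _ => d) y)]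
  exact (Fintype.sum_equiv (((Equiv.funUnique (Fin 1) (ZMod 2)).symm.prodCongr (Equiv.refl _)).trans
    (Equiv.sumArrowEquivProdArrow (Fin 1) (Fin n) (ZMod 2)).symm) _ _ fun _ => rfl).symm

theorem sum_char_succ {n : ℕ} {M : Type*} [AddCommMonoid M] (f : Char2 (Fin 1 ⊕ Fin n) → M) :
    ∑ m, f m = ∑ ε : Fin n → ZMod 2, ∑ δ : Fin n → ZMod 2,
      (f (extChar 0 0 ε δ) + f (extChar 0 1 ε δ) +
        (f (extChar 1 0 ε δ) + f (extChar 1 1 ε δ))) := by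
  simp only [Fintype.sum_prod_type, sum_zmod_two_sum_arrow, sum_zmod_two, Finset.sum_add_distrib]
  exact add_add_add_comm _ _ _ _

section Boundary

variable {n : ℕ} {τ : Matrix (Fin n) (Fin n) ℂ} {z : Fin n → ℂ} {c : ℝ}

theorem tendsto_qdeg_ofReal :
    Filter.Tendsto (fun t => (qdeg t : ℂ)) Filter.atTop (nhds 0) := by
  have h := (Complex.continuous_ofReal.tendsto 0).comp
    (tendsto_qdeg.mono_right nhdsWithin_le_nhds)
  simpa [Function.comp_def] using h

theorem qdeg_ofReal_ne_zero (t : ℝ) : (qdeg t : ℂ) ≠ 0 := by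
  exact_mod_cast (qdeg_pos t).ne'

theorem theta_zero_mul_theta_neg (ε δ : Fin n → ZMod 2) :
    theta ε δ τ 0 * theta ε δ τ (-z) = theta ε δ τ 0 * theta ε δ τ z := by
  have h0 := theta_neg ε δ τ 0
  rw [neg_zero] at h0
  rw [theta_neg]
  linear_combination (-theta ε δ τ z) * h0

theorem theta_add_neg_pow_eight (ε δ : Fin n → ZMod 2) (w : Fin n → ℂ) :
    (theta ε δ τ w + theta ε δ τ (-w)) ^ 8 +
      (Complex.I * (theta ε δ τ w - theta ε δ τ (-w))) ^ 8 = 256 * theta ε δ τ w ^ 8 := by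
  have hI : Complex.I ^ 8 = 1 := by
    rw [show 8 = 4 * 2 from rfl, pow_mul, Complex.I_pow_four, one_pow]
  rw [theta_neg, mul_pow, hI]
  rcases charSign_eq_one_or ε δ with h | h <;> rw [h] <;> ring

theorem tendsto_thetaConst_pow_eight (hc : 0 < c)
    (hT : ∀ᶠ t : ℝ in Filter.atTop, ImCoercive (Tmat t z τ) c) (ε δ : Fin n → ZMod 2) :
    Filter.Tendsto (fun t => ((qdeg t : ℂ))⁻¹ ^ 8 *
        (thetaConst (extChar 0 0 ε δ) (Tmat t z τ) ^ 8 +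
          thetaConst (extChar 0 1 ε δ) (Tmat t z τ) ^ 8 +
          (thetaConst (extChar 1 0 ε δ) (Tmat t z τ) ^ 8 +
            thetaConst (extChar 1 1 ε δ) (Tmat t z τ) ^ 8) - 2 * theta ε δ τ 0 ^ 8))
      Filter.atTop (nhds (224 * (theta ε δ τ 0 ^ 6 * theta ε δ τ z ^ 2) +
        256 * theta ε δ τ ((1 / 2 : ℂ) • z) ^ 8)) := by
  have h0 := tendsto_pow_eight_add_pow_eight qdeg_ofReal_ne_zero tendsto_qdeg_ofReal
    (tendsto_thetaConst_add hc hT ε δ) (tendsto_thetaConst_sub hc hT ε δ)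
  have h1 := ((tendsto_thetaConst_one_zero hc hT ε δ).pow 8).add
    ((tendsto_thetaConst_one_one hc hT ε δ).pow 8)
  rw [theta_add_neg_pow_eight] at h1
  convert! h0.add h1 using 2
  · ring
  · have h := theta_zero_mul_theta_neg (τ := τ) (z := z) ε δ
    congr 1
    linear_combination (-56 * theta ε δ τ 0 ^ 4 * (theta ε δ τ 0 * theta ε δ τ (-z) +
      3 * (theta ε δ τ 0 * theta ε δ τ z))) * h

theorem tendsto_thetaConst_pow_sixteen (hc : 0 < c)
    (hT : ∀ᶠ t : ℝ in Filter.atTop, ImCoercive (Tmat t z τ) c) (ε δ : Fin n → ZMod 2) :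
    Filter.Tendsto (fun t => ((qdeg t : ℂ))⁻¹ ^ 8 *
        (thetaConst (extChar 0 0 ε δ) (Tmat t z τ) ^ 16 +
          thetaConst (extChar 0 1 ε δ) (Tmat t z τ) ^ 16 +
          (thetaConst (extChar 1 0 ε δ) (Tmat t z τ) ^ 16 +
            thetaConst (extChar 1 1 ε δ) (Tmat t z τ) ^ 16) - 2 * theta ε δ τ 0 ^ 16))
      Filter.atTop (nhds (960 * (theta ε δ τ 0 ^ 14 * theta ε δ τ z ^ 2))) := by
  have h0 := tendsto_pow_sixteen_add_pow_sixteen qdeg_ofReal_ne_zero tendsto_qdeg_ofReal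
    (tendsto_thetaConst_add hc hT ε δ) (tendsto_thetaConst_sub hc hT ε δ)
  have h1 := (tendsto_qdeg_ofReal.pow 8).mul
    (((tendsto_thetaConst_one_zero hc hT ε δ).pow 16).add
      ((tendsto_thetaConst_one_one hc hT ε δ).pow 16))
  convert! h0.add h1 using 2 with t
  · have hq := qdeg_ofReal_ne_zero t
    field_simp
    ring
  · have h := theta_zero_mul_theta_neg (τ := τ) (z := z) ε δ
    linear_combination (-240 * theta ε δ τ 0 ^ 12 * (theta ε δ τ 0 * theta ε δ τ (-z) +
      3 * (theta ε δ τ 0 * theta ε δ τ z))) * h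

theorem tendsto_sum_thetaConst_pow_eight (hc : 0 < c) (hτ : ImCoercive τ c) {c' : ℝ} (hc' : 0 < c')
    (hT : ∀ᶠ t : ℝ in Filter.atTop, ImCoercive (Tmat t z τ) c') :
    Filter.Tendsto (fun t => ((qdeg t : ℂ))⁻¹ ^ 8 *
        (∑ m, thetaConst m (Tmat t z τ) ^ 8 - 2 * ∑ m, thetaConst m τ ^ 8))
      Filter.atTop (nhds (480 * ∑ ε : Fin n → ZMod 2, ∑ δ : Fin n → ZMod 2,
        theta ε δ τ 0 ^ 6 * theta ε δ τ z ^ 2)) := by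
  have h := tendsto_finsetSum Finset.univ fun (ε : Fin n → ZMod 2) _ =>
    tendsto_finsetSum Finset.univ fun (δ : Fin n → ZMod 2) _ =>
      tendsto_thetaConst_pow_eight hc' hT ε δ
  simp only [Finset.sum_add_distrib, ← Finset.mul_sum, Finset.sum_sub_distrib,
    sum_theta_half_pow_eight hc hτ] at h
  convert! h using 2
  · rw [sum_char_succ, Fintype.sum_prod_type]
    simp only [Finset.sum_add_distrib]
    rfl
  · ring

theorem tendsto_sum_thetaConst_pow_sixteen (hc : 0 < c)
    (hT : ∀ᶠ t : ℝ in Filter.atTop, ImCoercive (Tmat t z τ) c) :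
    Filter.Tendsto (fun t => ((qdeg t : ℂ))⁻¹ ^ 8 *
        (∑ m, thetaConst m (Tmat t z τ) ^ 16 - 2 * ∑ m, thetaConst m τ ^ 16))
      Filter.atTop (nhds (960 * ∑ ε : Fin n → ZMod 2, ∑ δ : Fin n → ZMod 2,
        theta ε δ τ 0 ^ 14 * theta ε δ τ z ^ 2)) := by
  have h := tendsto_finsetSum Finset.univ fun (ε : Fin n → ZMod 2) _ =>
    tendsto_finsetSum Finset.univ fun (δ : Fin n → ZMod 2) _ =>
      tendsto_thetaConst_pow_sixteen hc hT ε δ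
  simp only [Finset.sum_add_distrib, ← Finset.mul_sum, Finset.sum_sub_distrib] at h
  convert! h using 2
  rw [sum_char_succ, Fintype.sum_prod_type]
  simp only [Finset.sum_add_distrib]
  rfl

end Boundary


open Filter in
/-- The `q_t⁸`-coefficient of the expansion of `F_g` near the boundary. -/
theorem Fmod_boundary_q_eight_term (g : ℕ) (hg : 2 ≤ g)
    (τ : Matrix (Fin (g - 1)) (Fin (g - 1)) ℂ) (hτ : τ ∈ Siegel (Fin (g - 1)))
    (z : Fin (g - 1) → ℂ) :
    Tendsto (fun t : ℝ =>
        ((qdeg t : ℂ))⁻¹ ^ 8 *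
          (Fmod (Fin 1 ⊕ Fin (g - 1)) (Tmat t z τ) - 4 * Fmod (Fin (g - 1)) τ)) atTop
      (nhds (1920 *
        ((2 : ℂ) ^ (g - 1) *
            ∑ ε : Fin (g - 1) → ZMod 2, ∑ δ : Fin (g - 1) → ZMod 2,
              theta ε δ τ 0 ^ 14 * theta ε δ τ z ^ 2 -
          (∑ ε : Fin (g - 1) → ZMod 2, ∑ δ : Fin (g - 1) → ZMod 2, theta ε δ τ 0 ^ 8) *
            ∑ ε : Fin (g - 1) → ZMod 2, ∑ δ : Fin (g - 1) → ZMod 2,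
              theta ε δ τ 0 ^ 6 * theta ε δ τ z ^ 2))) := by
  obtain ⟨c, hc, hcτ⟩ := exists_imCoercive hτ
  obtain ⟨c', hc', hT⟩ := eventually_imCoercive_Tmat hc hcτ z
  have h8 := tendsto_sum_thetaConst_pow_eight hc hcτ hc' hT
  have h16 := tendsto_sum_thetaConst_pow_sixteen hc' hT
  have hsum := ((tendsto_qdeg_ofReal.pow 8).mul h8).add_const (4 * ∑ m, thetaConst m τ ^ 8)
  have h := (h16.const_mul ((2 : ℂ) ^ (1 + (g - 1)))).sub (h8.mul hsum)
  convert! h using 2 with t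
  · have hq := qdeg_ofReal_ne_zero t
    simp only [Fmod, Fintype.card_sum, Fintype.card_fin]
    field_simp
    ring
  · have hA : ∑ m, thetaConst m τ ^ 8 = ∑ ε : Fin (g - 1) → ZMod 2,
        ∑ δ : Fin (g - 1) → ZMod 2, theta ε δ τ 0 ^ 8 := by
      rw [Fintype.sum_prod_type]
      rfl
    rw [hA]
    ring
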